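/- arXiv:math/0605616 — 2 statements merged into one kernel-verified Lean document; each statement's English description precedes it below -/
import Mathlib

section
/- Let S₀ = {e₁, e₂, e₃, e₄, e₁+e₂+e₃+e₄} ⊆ F₂⁴, where e₁, …, e₄ are the standard basis vectors (this is the 2^{5−1} design with defining relation I = ABCDE). Then for every t ≥ 0, the t-fold double D^t(S₀) is a maximal cap of size 5 · 2^t in F₂^(4+t). (In design language: repeatedly doubling the 2^{5−1} design defined by I = ABCDE yields a family of maximal regular designs of resolution IV with n = 5N/16 factors.) -/
-- A design with N = 2^d runs and n factors is a Finset of nonzero vectors of F₂^d.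
-- The double D(S) ⊆ F₂^(d+1) consists of the vectors (v,0) and (v,1) for v ∈ S,
-- where (v,ε) appends the coordinate ε to v.
def double {d : ℕ} (S : Finset (Fin d → ZMod 2)) : Finset (Fin (d + 1) → ZMod 2) :=
  S.image (fun v => Fin.snoc v 0) ∪ S.image (fun v => Fin.snoc v 1)

-- The t-fold iterated double.
def iterDouble {d : ℕ} (S : Finset (Fin d → ZMod 2)) : (t : ℕ) → Finset (Fin (d + t) → ZMod 2)
  | 0 => S
  | t + 1 => double (iterDouble S t)

-- m_S(v): the number of unordered pairs {a, b} of distinct elements of S with a + b = v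
-- (the number of two-factor interactions in the alias set corresponding to v).
def mcount {d : ℕ} (S : Finset (Fin d → ZMod 2)) (v : Fin d → ZMod 2) : ℕ :=
  ((S.powersetCard 2).filter (fun T => T.sum id = v)).card

-- B_j(S): the number of j-element subsets of S summing to zero
-- (the number of defining words of length j).
def wordCount {d : ℕ} (S : Finset (Fin d → ZMod 2)) (j : ℕ) : ℕ :=
  ((S.powersetCard j).filter (fun T => T.sum id = 0)).card

-- S is a cap: a set of nonzero vectors no three distinct elements of which sum to zero
-- (i.e. the corresponding design has resolution at least IV).
def IsCap {d : ℕ} (S : Finset (Fin d → ZMod 2)) : Prop :=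
  (∀ v ∈ S, v ≠ 0) ∧
    ∀ a ∈ S, ∀ b ∈ S, ∀ c ∈ S, a ≠ b → b ≠ c → a ≠ c → a + b + c ≠ 0

-- S is a maximal cap: no nonzero vector outside S can be added keeping it a cap.
def IsMaximalCap {d : ℕ} (S : Finset (Fin d → ZMod 2)) : Prop :=
  IsCap S ∧ ∀ w : Fin d → ZMod 2, w ≠ 0 → w ∉ S → ¬ IsCap (insert w S)

-- The 2^{5-1} design with defining relation I = ABCDE, as a subset of F₂⁴.
def fiveHalf : Finset (Fin 4 → ZMod 2) :=
  {Pi.single 0 1, Pi.single 1 1, Pi.single 2 1, Pi.single 3 1,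
    Pi.single 0 1 + Pi.single 1 1 + Pi.single 2 1 + Pi.single 3 1}

theorem mem_double_iff {d : ℕ} {S : Finset (Fin d → ZMod 2)} {w : Fin (d + 1) → ZMod 2} :
    w ∈ double S ↔ (Fin.init w : Fin d → ZMod 2) ∈ S := by
  simp only [double, Finset.mem_union, Finset.mem_image]
  constructor
  · rintro (⟨v, hv, rfl⟩ | ⟨v, hv, rfl⟩) <;> simpa using hv
  · intro h
    have key : ∀ x : ZMod 2, x = 0 ∨ x = 1 := by decide
    rcases key (w (Fin.last d)) with hx | hx
    · exact Or.inl ⟨_, h, by rw [← hx]; exact Fin.snoc_init_self w⟩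
    · exact Or.inr ⟨_, h, by rw [← hx]; exact Fin.snoc_init_self w⟩

theorem card_double {d : ℕ} (S : Finset (Fin d → ZMod 2)) : (double S).card = S.card * 2 := by
  have hinj : ∀ x : ZMod 2,
      Function.Injective (fun v : Fin d → ZMod 2 => (Fin.snoc v x : Fin (d + 1) → ZMod 2)) :=
    fun x v w h => (Fin.snoc_inj.1 h).1
  rw [double, Finset.card_union_of_disjoint, Finset.card_image_of_injective _ (hinj 0),
    Finset.card_image_of_injective _ (hinj 1), mul_two]
  rw [Finset.disjoint_left]
  intro w h₀ h₁
  obtain ⟨v, -, rfl⟩ := Finset.mem_image.1 h₀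
  obtain ⟨u, -, hu⟩ := Finset.mem_image.1 h₁
  exact one_ne_zero (Fin.snoc_inj.1 hu).2

/-- A set is complete sum-free if its complement is exactly its sumset. -/
def IsCompleteSumFree {d : ℕ} (S : Finset (Fin d → ZMod 2)) : Prop :=
  ∀ w, w ∉ S ↔ ∃ a ∈ S, ∃ b ∈ S, a + b = w

theorem IsCompleteSumFree.double {d : ℕ} {S : Finset (Fin d → ZMod 2)}
    (hS : IsCompleteSumFree S) : IsCompleteSumFree (double S) := by
  intro w
  rw [mem_double_iff, hS]
  constructor
  · rintro ⟨a, ha, b, hb, hab⟩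
    refine ⟨Fin.snoc a 0, ?_, Fin.snoc b (w (Fin.last d)), ?_, ?_⟩
    · simpa [mem_double_iff] using ha
    · simpa [mem_double_iff] using hb
    · funext i
      refine Fin.lastCases ?_ (fun j => ?_) i
      · simp
      · simpa [Fin.init] using congrFun hab j
  · rintro ⟨a, ha, b, hb, rfl⟩
    exact ⟨_, mem_double_iff.1 ha, _, mem_double_iff.1 hb, rfl⟩

theorem IsCompleteSumFree.isMaximalCap {d : ℕ} {S : Finset (Fin d → ZMod 2)}
    (hS : IsCompleteSumFree S) : IsMaximalCap S := by
  have hself : ∀ v : Fin d → ZMod 2, v + v = 0 := fun v => funext fun i => CharTwo.add_self_eq_zero _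
  have hzero : ∀ v ∈ S, v ≠ 0 := by
    rintro v hv rfl
    exact (hS 0).2 ⟨0, hv, 0, hv, add_zero 0⟩ hv
  refine ⟨⟨hzero, fun a ha b hb c hc _ _ _ habc => ?_⟩, fun w hw hwS hcap => ?_⟩
  · refine (hS c).2 ⟨a, ha, b, hb, ?_⟩ hc
    rw [← add_zero (a + b), ← hself c, ← add_assoc, habc, zero_add]
  · obtain ⟨a, ha, b, hb, rfl⟩ := (hS w).1 hwS
    refine hcap.2 a (Finset.mem_insert_of_mem ha) b (Finset.mem_insert_of_mem hb) _
      (Finset.mem_insert_self _ _) ?_ ?_ ?_ (hself _)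
    · rintro rfl
      exact hw (hself a)
    · exact fun h => hwS (h ▸ hb)
    · exact fun h => hwS (h ▸ ha)

theorem isCompleteSumFree_fiveHalf : IsCompleteSumFree fiveHalf := by
  unfold IsCompleteSumFree
  decide

theorem isCompleteSumFree_iterDouble {d : ℕ} {S : Finset (Fin d → ZMod 2)}
    (hS : IsCompleteSumFree S) : ∀ t, IsCompleteSumFree (iterDouble S t)
  | 0 => hS
  | t + 1 => (isCompleteSumFree_iterDouble hS t).double

theorem card_iterDouble {d : ℕ} (S : Finset (Fin d → ZMod 2)) :
    ∀ t, (iterDouble S t).card = S.card * 2 ^ t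
  | 0 => (mul_one _).symm
  | t + 1 => by
    rw [iterDouble, card_double, card_iterDouble S t, pow_succ, mul_assoc]

-- Repeatedly doubling the 2^{5-1} design defined by I = ABCDE yields maximal caps with
-- n = 5N/16 factors: D^t(fiveHalf) is a maximal cap of size 5·2^t in F₂^(4+t).
theorem iterDouble_fiveHalf_maximal (t : ℕ) :
    IsMaximalCap (iterDouble fiveHalf t) ∧ (iterDouble fiveHalf t).card = 5 * 2 ^ t := by
  refine ⟨(isCompleteSumFree_iterDouble isCompleteSumFree_fiveHalf t).isMaximalCap, ?_⟩
  rw [card_iterDouble, show fiveHalf.card = 5 by decide]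
end

section
/- Let S₀ = {e₁, e₂, e₃, e₄, e₁+e₂+e₃+e₄} ⊆ F₂⁴ and for t ≥ 1 let S_t = D^t(S₀) ⊆ F₂^(4+t). Then every nonzero vector v ∈ F₂^(4+t) with v ∉ S_t satisfies m_{S_t}(v) = 2^t or m_{S_t}(v) = 5 · 2^(t−1); moreover, exactly 10 · 2^t such vectors v have m_{S_t}(v) = 2^t and exactly 2^t − 1 such vectors v have m_{S_t}(v) = 5 · 2^(t−1). (In design language: under the maximal resolution IV design with 5N/16 factors there are 10 · 2^t alias sets not containing main effects each containing 2^t two-factor interactions, and 2^t − 1 alias sets each containing 5 · 2^(t−1) two-factor interactions.) -/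
theorem pi_zmod_two_add_self {d : ℕ} (v : Fin d → ZMod 2) : v + v = 0 :=
  funext fun i => CharTwo.add_self_eq_zero (v i)

/-- The number of ordered pairs `(a, b)` of elements of `S` with `a + b = v`. -/
def pairCount {d : ℕ} (S : Finset (Fin d → ZMod 2)) (v : Fin d → ZMod 2) : ℕ :=
  (Finset.univ.filter fun a => a ∈ S ∧ v + a ∈ S).card

theorem pairCount_eq_two_mul_mcount {d : ℕ} (S : Finset (Fin d → ZMod 2))
    {v : Fin d → ZMod 2} (hv : v ≠ 0) : pairCount S v = 2 * mcount S v := by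
  have hne : ∀ a, a ≠ v + a := fun a h => hv (by simpa using h)
  unfold pairCount mcount
  rw [Finset.card_eq_sum_card_fiberwise (f := fun a => ({a, v + a} : Finset _))
    (t := (S.powersetCard 2).filter (fun T => T.sum id = v))]
  · rw [Finset.sum_congr rfl (g := fun _ => 2), Finset.sum_const, smul_eq_mul, mul_comm]
    intro T hT
    rw [Finset.mem_filter, Finset.mem_powersetCard] at hT
    obtain ⟨⟨hS, h2⟩, hsum⟩ := hT
    refine Eq.trans (congrArg Finset.card ?_) h2
    obtain ⟨a, b, hab, rfl⟩ := Finset.card_eq_two.mp h2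
    rw [Finset.sum_pair hab, id, id] at hsum
    subst hsum
    have hl : a + b + a = b := by rw [add_comm a b, add_assoc, pi_zmod_two_add_self, add_zero]
    have hr : a + b + b = a := by rw [add_assoc, pi_zmod_two_add_self, add_zero]
    have ha : a ∈ S := hS (by simp)
    have hb : b ∈ S := hS (by simp)
    ext x
    simp only [Finset.mem_filter, Finset.mem_univ, true_and]
    constructor
    · rintro ⟨_, hx⟩
      rw [← hx]
      simp
    · intro hx
      rcases Finset.mem_insert.mp hx with rfl | hx
      · rw [hl]
        exact ⟨⟨ha, hb⟩, rfl⟩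
      · rw [Finset.mem_singleton.mp hx, hr]
        exact ⟨⟨hb, ha⟩, Finset.pair_comm _ _⟩
  · intro a ha
    simp only [Finset.coe_filter, Finset.mem_univ, true_and, Set.mem_ofPred_eq,
      Finset.mem_powersetCard] at ha ⊢
    refine ⟨⟨?_, Finset.card_pair (hne a)⟩, ?_⟩
    · intro x hx
      rcases Finset.mem_insert.mp hx with rfl | hx
      · exact ha.1
      · exact Finset.mem_singleton.mp hx ▸ ha.2
    · rw [Finset.sum_pair (hne a), id, id, add_left_comm, pi_zmod_two_add_self, add_zero]

theorem pairCount_zero {d : ℕ} (S : Finset (Fin d → ZMod 2)) : pairCount S 0 = S.card := by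
  simp [pairCount]

theorem mem_double {d : ℕ} {S : Finset (Fin d → ZMod 2)} {v : Fin (d + 1) → ZMod 2} :
    v ∈ double S ↔ Fin.init (α := fun _ => ZMod 2) v ∈ S := by
  simp only [double, Finset.mem_union, Finset.mem_image]
  constructor
  · rintro (⟨w, hw, rfl⟩ | ⟨w, hw, rfl⟩) <;> simpa using hw
  · intro h
    have h01 : ∀ x : ZMod 2, x = 0 ∨ x = 1 := by decide
    rcases h01 (v (Fin.last d)) with hl | hl
    · exact Or.inl ⟨_, h, by rw [← hl, Fin.snoc_init_self]⟩
    · exact Or.inr ⟨_, h, by rw [← hl, Fin.snoc_init_self]⟩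

theorem card_filter_init {d : ℕ} (P : (Fin d → ZMod 2) → Prop) [DecidablePred P] :
    (Finset.univ.filter fun v : Fin (d + 1) → ZMod 2 =>
      P (Fin.init (α := fun _ => ZMod 2) v)).card = 2 * (Finset.univ.filter P).card := by
  have h : (Finset.univ.filter fun v : Fin (d + 1) → ZMod 2 =>
      P (Fin.init (α := fun _ => ZMod 2) v)).card =
      ((Finset.univ : Finset (ZMod 2)) ×ˢ Finset.univ.filter P).card := by
    refine Finset.card_equiv (Fin.snocEquiv fun _ => ZMod 2).symm fun v => ?_
    simp [Fin.snocEquiv]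
  rw [h, Finset.card_product, Finset.card_univ, ZMod.card]

theorem pairCount_double {d : ℕ} (S : Finset (Fin d → ZMod 2)) (v : Fin (d + 1) → ZMod 2) :
    pairCount (double S) v = 2 * pairCount S (Fin.init (α := fun _ => ZMod 2) v) := by
  unfold pairCount
  rw [← card_filter_init]
  simp only [mem_double]
  rfl

theorem card_filter_iterDouble_succ {d : ℕ} (S : Finset (Fin d → ZMod 2)) (t k : ℕ) :
    (Finset.univ.filter fun v => v ∉ iterDouble S (t + 1) ∧
        pairCount (iterDouble S (t + 1)) v = 2 * k).card =
      2 * (Finset.univ.filter fun v => v ∉ iterDouble S t ∧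
        pairCount (iterDouble S t) v = k).card := by
  rw [← card_filter_init]
  congr 1
  refine Finset.filter_congr fun v _ => ?_
  simp only [iterDouble, mem_double, pairCount_double]
  simp

theorem card_filter_iterDouble {d : ℕ} (S : Finset (Fin d → ZMod 2)) (t k : ℕ) :
    (Finset.univ.filter fun v => v ∉ iterDouble S t ∧
        pairCount (iterDouble S t) v = k * 2 ^ t).card =
      (Finset.univ.filter fun v => v ∉ S ∧ pairCount S v = k).card * 2 ^ t := by
  induction t with
  | zero => simp [iterDouble]
  | succ t ih =>
    rw [pow_succ, ← mul_assoc, ← mul_assoc, ← ih, mul_comm _ 2, mul_comm _ 2]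
    exact card_filter_iterDouble_succ S t _

theorem pairCount_fiveHalf : ∀ v : Fin 4 → ZMod 2,
    v ∉ fiveHalf → pairCount fiveHalf v = 2 ∨ pairCount fiveHalf v = 5 := by
  unfold pairCount fiveHalf
  decide

theorem card_filter_fiveHalf_two :
    (Finset.univ.filter fun v => v ∉ fiveHalf ∧ pairCount fiveHalf v = 2).card = 10 := by
  unfold pairCount fiveHalf
  decide

theorem card_filter_fiveHalf_five :
    (Finset.univ.filter fun v => v ∉ fiveHalf ∧ pairCount fiveHalf v = 5).card = 1 := by
  unfold pairCount fiveHalf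
  decide

theorem pairCount_iterDouble_fiveHalf (t : ℕ) : ∀ v : Fin (4 + t) → ZMod 2,
    v ∉ iterDouble fiveHalf t → pairCount (iterDouble fiveHalf t) v = 2 * 2 ^ t ∨
      pairCount (iterDouble fiveHalf t) v = 5 * 2 ^ t := by
  induction t with
  | zero => simpa [iterDouble] using pairCount_fiveHalf
  | succ t ih =>
    intro v hv
    have := ih (Fin.init (α := fun _ => ZMod 2) v) (fun h => hv (mem_double.mpr h))
    have h2 := pairCount_double (iterDouble fiveHalf t) v
    rw [pow_succ]
    change pairCount (double _) v = _ ∨ pairCount (double _) v = _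
    omega

theorem zero_notMem_iterDouble {d : ℕ} {S : Finset (Fin d → ZMod 2)} (h : 0 ∉ S) (t : ℕ) :
    0 ∉ iterDouble S t := by
  induction t with
  | zero => exact h
  | succ t ih => exact fun h0 => ih (mem_double.mp h0)

theorem pairCount_iterDouble_zero {d : ℕ} (S : Finset (Fin d → ZMod 2)) (t : ℕ) :
    pairCount (iterDouble S t) 0 = S.card * 2 ^ t := by
  induction t with
  | zero => simp [iterDouble, pairCount_zero]
  | succ t ih =>
    rw [pow_succ, ← mul_assoc, ← ih, mul_comm]
    exact pairCount_double (iterDouble S t) 0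

-- Alias structure of S_t = D^t(fiveHalf), t ≥ 1: every nonzero v ∉ S_t has
-- m_{S_t}(v) = 2^t or 5·2^(t-1); exactly 10·2^t such v have m = 2^t and exactly
-- 2^t - 1 such v have m = 5·2^(t-1).
theorem mcount_iterDouble_fiveHalf (t : ℕ) (ht : 1 ≤ t) :
    (∀ v : Fin (4 + t) → ZMod 2, v ≠ 0 → v ∉ iterDouble fiveHalf t →
        mcount (iterDouble fiveHalf t) v = 2 ^ t ∨
        mcount (iterDouble fiveHalf t) v = 5 * 2 ^ (t - 1)) ∧
      (Finset.univ.filter fun v : Fin (4 + t) → ZMod 2 =>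
          v ≠ 0 ∧ v ∉ iterDouble fiveHalf t ∧
            mcount (iterDouble fiveHalf t) v = 2 ^ t).card = 10 * 2 ^ t ∧
      (Finset.univ.filter fun v : Fin (4 + t) → ZMod 2 =>
          v ≠ 0 ∧ v ∉ iterDouble fiveHalf t ∧
            mcount (iterDouble fiveHalf t) v = 5 * 2 ^ (t - 1)).card = 2 ^ t - 1 := by
  have hcard : fiveHalf.card = 5 := by decide
  have h0 := zero_notMem_iterDouble (S := fiveHalf) (by decide) t
  have hz := pairCount_iterDouble_zero fiveHalf t
  rw [hcard] at hz
  have hc2 := card_filter_iterDouble fiveHalf t 2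
  have hc5 := card_filter_iterDouble fiveHalf t 5
  rw [card_filter_fiveHalf_two] at hc2
  rw [card_filter_fiveHalf_five, one_mul] at hc5
  have hpair := pairCount_iterDouble_fiveHalf t
  have hm := fun v hv => pairCount_eq_two_mul_mcount (iterDouble fiveHalf t) (v := v) hv
  have hpow : 2 ^ t = 2 * 2 ^ (t - 1) := by rw [← pow_succ', Nat.sub_add_cancel ht]
  have hpos : 0 < 2 ^ (t - 1) := by positivity
  refine ⟨fun v hv hvS => ?_, ?_, ?_⟩
  · have := hpair v hvS
    have := hm v hv
    omega
  · rw [← hc2]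
    congr 1
    refine Finset.filter_congr fun v _ => ?_
    constructor
    · rintro ⟨hv, hvS, h⟩
      exact ⟨hvS, by rw [hm v hv, h]⟩
    · rintro ⟨hvS, h⟩
      have hv : v ≠ 0 := by
        rintro rfl
        omega
      have := hm v hv
      exact ⟨hv, hvS, by omega⟩
  · rw [← hc5, ← Finset.card_erase_of_mem (a := 0) (by simpa using ⟨h0, hz⟩)]
    congr 1
    ext v
    simp only [Finset.mem_filter, Finset.mem_univ, true_and, Finset.mem_erase]
    refine and_congr_right fun hv => and_congr_right fun _ => ?_
    have := hm v hv
    omega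
end
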